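/- Let 𝕊 = {z ∈ ℂ : 0 < Re z < 1} be the open unit strip, let 𝔻 be the open unit disc, and let θ ∈ (0,1) be a real number. Then the function φ_θ(z) = sin(π(z−θ)/2) / sin(π(z+θ)/2) is well defined and analytic on 𝕊 (the denominator does not vanish on the closed strip), maps 𝕊 bijectively onto 𝔻 (hence is a conformal equivalence), satisfies φ_θ(θ) = 0, and its derivative at θ is φ'_θ(θ) = π / (2 sin(πθ)). -/

import Mathlib

open Complex Metric Set Real

noncomputable section

/-- The norms of `sin (Z + t)` and `sin (Z - t)` for real `t`, compared. -/
theorem normSq_sin_add_sub_normSq_sin_sub (Z : ℂ) (t : ℝ) :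
    normSq (Complex.sin (Z + t)) - normSq (Complex.sin (Z - t)) =
      Real.sin (2 * Z.re) * Real.sin (2 * t) := by
  have key (x y : ℝ) : normSq (Complex.sin (x + y * I)) =
      Real.sin x ^ 2 + Real.sinh y ^ 2 := by
    rw [Complex.sin_add_mul_I, ← Complex.ofReal_sin, ← Complex.ofReal_cos,
      ← Complex.ofReal_sinh, ← Complex.ofReal_cosh, ← Complex.ofReal_mul,
      ← Complex.ofReal_mul, normSq_add_mul_I]
    have h1 := Real.cosh_sq y
    have h2 := Real.sin_sq_add_cos_sq x
    linear_combination Real.sin x ^ 2 * h1 + Real.sinh y ^ 2 * h2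
  have h1 : Z + t = ((Z.re + t : ℝ) : ℂ) + Z.im * I := by
    apply Complex.ext <;> simp
  have h2 : Z - t = ((Z.re - t : ℝ) : ℂ) + Z.im * I := by
    apply Complex.ext <;> simp
  rw [h1, h2, key, key, Real.sin_add, Real.sin_sub, Real.sin_two_mul, Real.sin_two_mul]
  ring

theorem sin_ne_zero_of_re_pos_of_re_lt_pi {Z : ℂ} (h0 : 0 < Z.re) (h1 : Z.re < π) :
    Complex.sin Z ≠ 0 := by
  intro h
  obtain ⟨k, hk⟩ := Complex.sin_eq_zero_iff.mp h
  have hre : Z.re = k * π := by simp [hk]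
  refine (Real.sin_pos_of_pos_of_lt_pi h0 h1).ne' ?_
  rw [hre, Real.sin_int_mul_pi]

/-- Each `w` in the unit disc is a value of `sin (Z - t) / sin (Z + t)` on a strip that is one
period wide. -/
theorem exists_sin_sub_eq_mul_sin_add (t : ℝ) {w : ℂ} (hw : ‖w‖ < 1) :
    ∃ Z : ℂ, -(π / 2) < Z.re ∧ Z.re ≤ π / 2 ∧
      Complex.sin (Z - t) = w * Complex.sin (Z + t) := by
  have hne (s : ℝ) : Complex.exp (s * I) - w * Complex.exp (-s * I) ≠ 0 := by
    intro h
    have h' := congrArg norm (sub_eq_zero.mp h)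
    rw [norm_mul, ← Complex.ofReal_neg, Complex.norm_exp_ofReal_mul_I,
      Complex.norm_exp_ofReal_mul_I] at h'
    linarith
  have ha := hne t
  have hb := hne (-t)
  push_cast at hb
  rw [neg_neg] at hb
  set u := (Complex.exp (t * I) - w * Complex.exp (-t * I)) /
    (Complex.exp (-t * I) - w * Complex.exp (t * I)) with hu
  have hre : (-(Complex.log u / 2) * I).re = u.arg / 2 := by
    simp [Complex.log_im]
  refine ⟨-(Complex.log u / 2) * I, ?_, ?_, ?_⟩
  · rw [hre]; linarith [Complex.neg_pi_lt_arg u]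
  · rw [hre]; linarith [Complex.arg_le_pi u]
  · have hE : Complex.exp (Complex.log u / 2) * Complex.exp (Complex.log u / 2) = u := by
      rw [← Complex.exp_add, add_halves, Complex.exp_log (div_ne_zero ha hb)]
    rw [eq_div_iff hb] at hu
    have e1 : Complex.exp (Complex.log u / 2) * Complex.exp (-(Complex.log u / 2)) = 1 := by
      rw [← Complex.exp_add, add_neg_cancel, Complex.exp_zero]
    simp only [Complex.sin, neg_mul, add_mul, neg_add, sub_eq_add_neg, neg_neg,
      Complex.exp_add, mul_assoc, I_mul_I, mul_neg, mul_one] at *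
    generalize Complex.exp (Complex.log u / 2) = E at *
    generalize Complex.exp (-(Complex.log u / 2)) = F at *
    generalize Complex.exp (t * I) = T at *
    generalize Complex.exp (-(t * I)) = T' at *
    rw [← hE] at hu
    linear_combination (-I / 2 * F) * hu + (I / 2 * E * (T' - w * T)) * e1

/-- For `0 < θ < 1`, the function `φ_θ(z) = sin(π(z-θ)/2)/sin(π(z+θ)/2)` is well defined and
analytic on the open unit strip `S` (its denominator does not vanish on the closed strip),
is a conformal equivalence of `S` onto the open unit disc, vanishes at `θ`, and its derivative
at `θ` equals `π/(2 sin(πθ))`. -/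
theorem statement14 (θ : ℝ) (hθ0 : 0 < θ) (hθ1 : θ < 1)
    (S : Set ℂ) (hS : S = {z : ℂ | 0 < z.re ∧ z.re < 1})
    (φ : ℂ → ℂ)
    (hφ : φ = fun z => Complex.sin (↑π * (z - ↑θ) / 2) / Complex.sin (↑π * (z + ↑θ) / 2)) :
    (∀ z : ℂ, 0 ≤ z.re → z.re ≤ 1 → Complex.sin (↑π * (z + ↑θ) / 2) ≠ 0) ∧
    DifferentiableOn ℂ φ S ∧
    Set.BijOn φ S (Metric.ball (0 : ℂ) 1) ∧
    φ (θ : ℂ) = 0 ∧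
    deriv φ (θ : ℂ) = ↑π / (2 * Complex.sin (↑π * ↑θ)) := by
  have hπ := Real.pi_pos
  set t : ℝ := π * θ / 2 with ht
  have hsub (z : ℂ) : (π : ℂ) * (z - θ) / 2 = π * z / 2 - t := by
    rw [ht]; push_cast; ring
  have hadd (z : ℂ) : (π : ℂ) * (z + θ) / 2 = π * z / 2 + t := by
    rw [ht]; push_cast; ring
  have hre (z : ℂ) : ((π : ℂ) * z / 2).re = π * z.re / 2 := by simp
  have hden (z : ℂ) (h0 : 0 ≤ z.re) (h1 : z.re ≤ 1) :
      Complex.sin (π * (z + θ) / 2) ≠ 0 := by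
    apply sin_ne_zero_of_re_pos_of_re_lt_pi <;> rw [hre, add_re, ofReal_re] <;> nlinarith
  have hsin2t : 0 < Real.sin (2 * t) := by
    apply Real.sin_pos_of_pos_of_lt_pi <;> rw [ht] <;> nlinarith
  have hsin2t' : Complex.sin (2 * t) ≠ 0 := by exact_mod_cast hsin2t.ne'
  have hderiv (z : ℂ) (h0 : 0 ≤ z.re) (h1 : z.re ≤ 1) : HasDerivAt φ
      ((Complex.cos (π * (z - θ) / 2) * (π / 2) * Complex.sin (π * (z + θ) / 2) -
        Complex.sin (π * (z - θ) / 2) * (Complex.cos (π * (z + θ) / 2) * (π / 2))) /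
          Complex.sin (π * (z + θ) / 2) ^ 2) z := by
    have hlin (c : ℂ) : HasDerivAt (fun z : ℂ => (π : ℂ) * (z + c) / 2) (π / 2) z := by
      simpa using (((hasDerivAt_id z).add_const c).const_mul (π : ℂ)).div_const 2
    have hlin' : HasDerivAt (fun z : ℂ => (π : ℂ) * (z - θ) / 2) (π / 2) z := by
      simpa only [sub_eq_add_neg] using hlin (-θ)
    rw [hφ]
    exact hlin'.csin.fun_div (hlin θ).csin (hden z h0 h1)
  have hθre0 : 0 ≤ (θ : ℂ).re := by simpa using hθ0.le
  have hθre1 : (θ : ℂ).re ≤ 1 := by simpa using hθ1.le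
  refine ⟨hden, ?_, ⟨?_, ?_, ?_⟩, ?_, ?_⟩
  · rw [hS]
    exact fun z hz => (hderiv z hz.1.le hz.2.le).differentiableAt.differentiableWithinAt
  · rw [hS]
    rintro z ⟨h0, h1⟩
    have hd := hden z h0.le h1.le
    rw [mem_ball_zero_iff, hφ]
    dsimp only
    rw [norm_div, div_lt_one (norm_pos_iff.mpr hd), ← sq_lt_sq₀ (norm_nonneg _) (norm_nonneg _),
      ← normSq_eq_norm_sq, ← normSq_eq_norm_sq, ← sub_pos, hsub, hadd,
      normSq_sin_add_sub_normSq_sin_sub, hre]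
    refine mul_pos (Real.sin_pos_of_pos_of_lt_pi ?_ ?_) hsin2t <;> nlinarith
  · rw [hS]
    rintro z ⟨hz0, hz1⟩ w ⟨hw0, hw1⟩ h
    rw [hφ] at h
    dsimp only at h
    rw [div_eq_div_iff (hden z hz0.le hz1.le) (hden w hw0.le hw1.le), hsub, hsub, hadd, hadd] at h
    have hprod : Complex.sin (2 * t) * Complex.sin (π * z / 2 - π * w / 2) = 0 := by
      rw [Complex.sin_two_mul, Complex.sin_sub]
      simp only [Complex.sin_sub, Complex.sin_add] at h
      linear_combination h
    obtain ⟨k, hk⟩ := Complex.sin_eq_zero_iff.mp ((mul_eq_zero.mp hprod).resolve_left hsin2t')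
    have hkre : π * z.re / 2 - π * w.re / 2 = k * π := by
      simpa using congrArg Complex.re hk
    have hkz : z.re - w.re = 2 * k := by
      apply mul_left_cancel₀ hπ.ne'
      linear_combination 2 * hkre
    have hk0 : k = 0 := by
      have : (-1 : ℝ) < k := by linarith
      have : (k : ℝ) < 1 := by linarith
      have : -1 < k := by exact_mod_cast ‹(-1 : ℝ) < k›
      have : k < 1 := by exact_mod_cast ‹(k : ℝ) < 1›
      lia
    rw [hk0, Int.cast_zero, zero_mul] at hk
    have hπ' : (π : ℂ) ≠ 0 := by exact_mod_cast hπ.ne'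
    apply mul_left_cancel₀ hπ'
    linear_combination 2 * hk
  · intro w hw
    rw [mem_ball_zero_iff] at hw
    obtain ⟨Z, hZ0, hZ1, hZ⟩ := exists_sin_sub_eq_mul_sin_add t hw
    have hZd : Complex.sin (Z + t) ≠ 0 := by
      intro h
      rw [h, mul_zero] at hZ
      apply hsin2t'
      rw [show (2 * t : ℂ) = (Z + t) - (Z - t) by ring, Complex.sin_sub, h, hZ]
      ring
    have hsinZ : 0 < Real.sin (2 * Z.re) := by
      refine pos_of_mul_pos_left ?_ hsin2t.le
      rw [← normSq_sin_add_sub_normSq_sin_sub, hZ, normSq_mul, normSq_eq_norm_sq w]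
      have := normSq_pos.mpr hZd
      have : ‖w‖ ^ 2 < 1 := by nlinarith [norm_nonneg w]
      nlinarith
    have hZpos : 0 < Z.re := by
      by_contra! h
      have := Real.sin_nonpos_of_nonpos_of_neg_pi_le
        (show 2 * Z.re ≤ 0 by linarith) (by linarith)
      linarith
    have hZlt : Z.re < π / 2 := by
      refine lt_of_le_of_ne hZ1 fun h => hsinZ.ne' ?_
      rw [h, mul_div_cancel₀ _ two_ne_zero, Real.sin_pi]
    have hπ' : (π : ℂ) ≠ 0 := by exact_mod_cast hπ.ne'
    have hz : (π : ℂ) * (2 * Z / π) / 2 = Z := by field_simp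
    have hzre : π * (2 * Z / π).re / 2 = Z.re := by rw [← hre, hz]
    refine ⟨2 * Z / π, ?_, ?_⟩
    · rw [hS]
      constructor <;> nlinarith
    · rw [hφ]
      dsimp only
      rw [hsub, hadd, hz, hZ, mul_div_cancel_right₀ _ hZd]
  · simp [hφ]
  · rw [(hderiv θ hθre0 hθre1).deriv]
    have h := hden θ hθre0 hθre1
    have hθ2 : (π : ℂ) * (θ + θ) / 2 = π * θ := by ring
    rw [hθ2] at h ⊢
    rw [sub_self, mul_zero, zero_div, Complex.sin_zero, Complex.cos_zero]
    field_simp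
    ring
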